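/- (Dubinskiĭ's theorem, case (b).) Let T > 0, let A₀ and A₁ be real Banach spaces with A₀ continuously embedded in A₁, and let M₊ be a seminormed nonnegative cone in A₀ that is compactly embedded in A₀. Let 1 ≤ p < ∞ and p₁ = 1. Then Y₊ is compactly embedded in L^p(0,T; A₀): every sequence (u_n) in Y₊ with sup_n [u_n]_{Y₊} < ∞ has a subsequence that converges in the norm of L^p(0,T; A₀). -/

import Mathlib

open Filter Topology MeasureTheory
open scoped ENNReal

theorem ehrling_aux
    {A₀ A₁ : Type*} [NormedAddCommGroup A₀] [NormedSpace ℝ A₀]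
    [NormedAddCommGroup A₁] [NormedSpace ℝ A₁]
    (ι : A₀ →L[ℝ] A₁) (hι : Function.Injective ι)
    (S : Set A₀) (ν : A₀ → ℝ)
    (hcone : ∀ φ ∈ S, ∀ c : ℝ, 0 ≤ c → c • φ ∈ S)
    (hν0 : ∀ φ ∈ S, 0 ≤ ν φ)
    (hνeq0 : ∀ φ ∈ S, (ν φ = 0 ↔ φ = 0))
    (hνhom : ∀ φ ∈ S, ∀ c : ℝ, 0 ≤ c → ν (c • φ) = c * ν φ)
    (hcpt : ∀ a : ℕ → A₀, (∀ n, a n ∈ S) → (∃ K : ℝ, ∀ n, ν (a n) ≤ K) →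
      ∃ (ψ : ℕ → ℕ) (l : A₀), StrictMono ψ ∧
        Tendsto (fun n => a (ψ n)) atTop (𝓝 l))
    (η : ℝ) (hη : 0 < η) :
    ∃ D : ℝ, 0 < D ∧ ∀ φ ∈ S, ∀ ψ ∈ S,
      ‖φ - ψ‖ ≤ η * (ν φ + ν ψ) + D * ‖ι φ - ι ψ‖ := by
  by_contra hcon
  push Not at hcon
  have h1 : ∀ n : ℕ, ∃ φ ∈ S, ∃ ψ ∈ S, ν φ + ν ψ = 1 ∧
      η + (n + 1 : ℝ) * ‖ι φ - ι ψ‖ < ‖φ - ψ‖ := by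
    intro n
    obtain ⟨φ, hφ, ψ, hψ, h⟩ := hcon (n + 1) (by positivity)
    have a0 := hν0 φ hφ
    have b0 := hν0 ψ hψ
    have hs : 0 < ν φ + ν ψ := by
      rcases (add_nonneg a0 b0).eq_or_lt with h0 | h0
      · exfalso
        have e1 : φ = 0 := (hνeq0 φ hφ).1 (by linarith)
        have e2 : ψ = 0 := (hνeq0 ψ hψ).1 (by linarith)
        rw [← h0] at h
        simp [e1, e2] at h
      · exact h0
    set s := ν φ + ν ψ with hsdef
    have hs' : 0 ≤ s⁻¹ := by positivity
    refine ⟨s⁻¹ • φ, hcone _ hφ _ hs', s⁻¹ • ψ, hcone _ hψ _ hs', ?_, ?_⟩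
    · rw [hνhom _ hφ _ hs', hνhom _ hψ _ hs', ← mul_add, ← hsdef]
      field_simp
    · rw [map_smul, map_smul, ← smul_sub, ← smul_sub, norm_smul, norm_smul, Real.norm_of_nonneg hs']
      have := mul_lt_mul_of_pos_left h (inv_pos.2 hs)
      calc _ = s⁻¹ * (η * s + (n+1) * ‖ι φ - ι ψ‖) := by field_simp
        _ < _ := this
  choose φ hφ ψ hψ hsum hlt using h1
  have hb1 : ∀ n, ν (φ n) ≤ 1 := fun n => by linarith [hsum n, hν0 _ (hψ n)]
  have hb2 : ∀ n, ν (ψ n) ≤ 1 := fun n => by linarith [hsum n, hν0 _ (hφ n)]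
  obtain ⟨α, l, hα, hl⟩ := hcpt φ hφ ⟨1, hb1⟩
  obtain ⟨β, m, hβ, hm⟩ := hcpt (fun n => ψ (α n)) (fun n => hψ _) ⟨1, fun n => hb2 _⟩
  have hl' := hl.comp hβ.tendsto_atTop
  have hd : Tendsto (fun n => φ (α (β n)) - ψ (α (β n))) atTop (𝓝 (l - m)) := hl'.sub hm
  have hmono : StrictMono (fun n => α (β n)) := hα.comp hβ
  have hιd : Tendsto (fun n => ‖ι (φ (α (β n))) - ι (ψ (α (β n)))‖) atTop (𝓝 ‖ι (l - m)‖) := by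
    have := ((ι.continuous.tendsto _).comp hd).norm
    simpa [Function.comp_def] using this
  have hz : Tendsto (fun n => ‖ι (φ (α (β n))) - ι (ψ (α (β n)))‖) atTop (𝓝 0) := by
    have hup : Tendsto (fun n : ℕ => ‖φ (α (β n)) - ψ (α (β n))‖ * (1 / ((n : ℝ) + 1))) atTop (𝓝 0) := by
      simpa using hd.norm.mul tendsto_one_div_add_atTop_nhds_zero_nat
    refine squeeze_zero (fun n => norm_nonneg _) (fun n => ?_) hup
    have h2 := hlt (α (β n))
    have h3 : (n : ℝ) ≤ α (β n) := by exact_mod_cast hmono.le_apply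
    rw [mul_one_div, le_div_iff₀ (by positivity)]
    nlinarith [norm_nonneg (ι (φ (α (β n))) - ι (ψ (α (β n))))]
  have e0 : ‖ι (l - m)‖ = 0 := tendsto_nhds_unique hιd hz
  have e1 : l - m = 0 := hι (by simpa using e0)
  rw [e1] at hd
  have h4 : η ≤ ‖(0 : A₀)‖ := by
    refine ge_of_tendsto' hd.norm (fun n => ?_)
    have h2 := hlt (α (β n))
    have : 0 ≤ ((α (β n) : ℝ) + 1) * ‖ι (φ (α (β n))) - ι (ψ (α (β n)))‖ := by positivity
    linarith
  simp at h4
  linarith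

theorem totBdd_aux {A₀ : Type*} [NormedAddCommGroup A₀] (B : Set A₀)
    (h : ∀ a : ℕ → A₀, (∀ n, a n ∈ B) → ∃ (ψ : ℕ → ℕ) (l : A₀), StrictMono ψ ∧
        Tendsto (fun n => a (ψ n)) atTop (𝓝 l)) : TotallyBounded B := by
  have : IsSeqCompact (closure B) := by
    intro x hx
    have : ∀ n : ℕ, ∃ a ∈ B, dist (x n) a < 1 / ((n : ℝ) + 1) := fun n =>
      Metric.mem_closure_iff.1 (hx n) _ (by positivity)
    choose a ha hxa using this
    obtain ⟨ψ, l, hψ, hl⟩ := h a ha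
    refine ⟨l, mem_closure_of_tendsto hl (Eventually.of_forall fun n => ha _), ψ, hψ, ?_⟩
    refine (tendsto_iff_of_dist ?_).2 hl
    exact squeeze_zero (fun n => dist_nonneg) (fun n => (hxa (ψ n)).le)
      (tendsto_one_div_add_atTop_nhds_zero_nat.comp hψ.tendsto_atTop)
  exact this.totallyBounded.subset subset_closure

/-- mass of `w` in the cell of `t` -/
noncomputable def cellMass {A₁ : Type*} [NormedAddCommGroup A₁] (T h : ℝ) (w : ℝ → A₁) (t : ℝ) : ℝ≥0∞ :=
  ∫⁻ s in Set.Ioc (0:ℝ) T, {q : ℝ × ℝ | ⌈q.1 / h⌉ = ⌈q.2 / h⌉}.indicator (fun q => ‖w q.2‖ₑ) (t, s)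

theorem cell_eq (h : ℝ) (hh : 0 < h) (j : ℤ) :
    {t : ℝ | ⌈t / h⌉ = j} = Set.Ioc ((j - 1) * h) (j * h) := by
  ext t
  simp only [Set.mem_ofPred_eq, Int.ceil_eq_iff, Set.mem_Ioc, lt_div_iff₀ hh, div_le_iff₀ hh]

theorem cellMass_eq {A₁ : Type*} [NormedAddCommGroup A₁] (T h : ℝ) (hh : 0 < h) (w : ℝ → A₁) (t : ℝ) :
    cellMass T h w t = ∫⁻ s in Set.Ioc (0:ℝ) T, (Set.Ioc ((⌈t / h⌉ - 1) * h) (⌈t / h⌉ * h)).indicator (fun s => ‖w s‖ₑ) s := by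
  unfold cellMass
  refine lintegral_congr fun s => ?_
  rw [← cell_eq h hh]
  simp only [Set.indicator_apply, Set.mem_ofPred_eq, eq_comm]

theorem cellMass_le {A₁ : Type*} [NormedAddCommGroup A₁] (T h : ℝ) (w : ℝ → A₁) (t : ℝ) :
    cellMass T h w t ≤ ∫⁻ s in Set.Ioc (0:ℝ) T, ‖w s‖ₑ := by
  refine lintegral_mono fun s => ?_
  exact Set.indicator_le_self _ (fun q : ℝ × ℝ => ‖w q.2‖ₑ) (t, s)

theorem cellMass_meas_aux {A₁ : Type*} [NormedAddCommGroup A₁] (T h : ℝ) (w : ℝ → A₁)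
    (hw : AEStronglyMeasurable w (volume.restrict (Set.Ioc (0 : ℝ) T))) :
    AEMeasurable (fun q : ℝ × ℝ => {q : ℝ × ℝ | ⌈q.1 / h⌉ = ⌈q.2 / h⌉}.indicator (fun q => ‖w q.2‖ₑ) q)
      ((volume.restrict (Set.Ioc (0 : ℝ) T)).prod (volume.restrict (Set.Ioc (0 : ℝ) T))) := by
  refine AEMeasurable.indicator ?_ ?_
  · exact (hw.comp_snd).enorm
  · exact measurableSet_eq_fun (by fun_prop) (by fun_prop)

theorem cellMass_meas {A₁ : Type*} [NormedAddCommGroup A₁] (T h : ℝ) (w : ℝ → A₁)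
    (hw : AEStronglyMeasurable w (volume.restrict (Set.Ioc (0 : ℝ) T))) :
    AEMeasurable (cellMass T h w) (volume.restrict (Set.Ioc (0 : ℝ) T)) :=
  (cellMass_meas_aux T h w hw).lintegral_prod_right'

theorem cellMass_int {A₁ : Type*} [NormedAddCommGroup A₁] (T h : ℝ) (hh : 0 < h) (w : ℝ → A₁)
    (hw : AEStronglyMeasurable w (volume.restrict (Set.Ioc (0 : ℝ) T))) :
    ∫⁻ t in Set.Ioc (0:ℝ) T, cellMass T h w t ≤ ENNReal.ofReal h * ∫⁻ s in Set.Ioc (0:ℝ) T, ‖w s‖ₑ := by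
  unfold cellMass
  rw [lintegral_lintegral_swap (cellMass_meas_aux T h w hw), ← lintegral_const_mul'' _ hw.enorm]
  refine lintegral_mono fun s => ?_
  have : ∀ t, {q : ℝ × ℝ | ⌈q.1 / h⌉ = ⌈q.2 / h⌉}.indicator (fun q => ‖w q.2‖ₑ) (t, s)
      = (Set.Ioc ((⌈s / h⌉ - 1) * h) (⌈s / h⌉ * h)).indicator (fun _ => ‖w s‖ₑ) t := by
    intro t
    rw [← cell_eq h hh]
    simp only [Set.indicator_apply, Set.mem_ofPred_eq]
  simp_rw [this]
  rw [lintegral_indicator_const measurableSet_Ioc, mul_comm]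
  gcongr
  refine (Measure.restrict_apply_le _ _).trans ?_
  rw [Real.volume_Ioc]
  exact le_of_eq (by ring_nf)

theorem cellMass_eLpNorm {A₁ : Type*} [NormedAddCommGroup A₁] (T h : ℝ) (hh : 0 < h) (w : ℝ → A₁)
    (hw : AEStronglyMeasurable w (volume.restrict (Set.Ioc (0 : ℝ) T)))
    (p : ℝ≥0∞) (hp : 1 ≤ p) (hp' : p ≠ ⊤) (κ : ℝ≥0∞)
    (hκ : ∫⁻ s in Set.Ioc (0:ℝ) T, ‖w s‖ₑ ≤ κ) :
    eLpNorm (fun t => (cellMass T h w t).toReal) p (volume.restrict (Set.Ioc (0 : ℝ) T))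
      ≤ κ * ENNReal.ofReal h ^ (1 / p.toReal) := by
  have hp1 : 1 ≤ p.toReal := by
    have := ENNReal.toReal_mono hp' hp
    simpa using this
  have hp0 : p ≠ 0 := (lt_of_lt_of_le one_pos hp).ne'
  rw [eLpNorm_eq_lintegral_rpow_enorm_toReal hp0 hp']
  have key : ∫⁻ t in Set.Ioc (0:ℝ) T, ‖(cellMass T h w t).toReal‖ₑ ^ p.toReal
      ≤ κ ^ p.toReal * ENNReal.ofReal h := by
    calc _ ≤ ∫⁻ t in Set.Ioc (0:ℝ) T, κ ^ (p.toReal - 1) * cellMass T h w t := by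
          refine lintegral_mono fun t => ?_
          have e : p.toReal = (p.toReal - 1) + 1 := by ring
          have h1 : ‖(cellMass T h w t).toReal‖ₑ ≤ cellMass T h w t := by
            rw [Real.enorm_of_nonneg ENNReal.toReal_nonneg]
            exact ENNReal.ofReal_toReal_le
          calc ‖(cellMass T h w t).toReal‖ₑ ^ p.toReal ≤ (cellMass T h w t) ^ p.toReal := by gcongr
            _ = (cellMass T h w t) ^ (p.toReal - 1) * cellMass T h w t := by
              conv_lhs => rw [e]
              rw [ENNReal.rpow_add_of_nonneg _ _ (by linarith) zero_le_one, ENNReal.rpow_one]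
            _ ≤ _ := by
              gcongr
              · exact (cellMass_le T h w t).trans hκ
      _ = κ ^ (p.toReal - 1) * ∫⁻ t in Set.Ioc (0:ℝ) T, cellMass T h w t :=
          lintegral_const_mul'' _ (cellMass_meas T h w hw)
      _ ≤ κ ^ (p.toReal - 1) * (ENNReal.ofReal h * κ) := by
          gcongr
          exact (cellMass_int T h hh w hw).trans (by gcongr)
      _ = κ ^ p.toReal * ENNReal.ofReal h := by
          conv_rhs => rw [show p.toReal = (p.toReal - 1) + 1 by ring]
          rw [ENNReal.rpow_add_of_nonneg _ _ (by linarith) zero_le_one, ENNReal.rpow_one]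
          ring
  calc _ ≤ (κ ^ p.toReal * ENNReal.ofReal h) ^ (1 / p.toReal) := by gcongr
    _ = _ := by
      rw [ENNReal.mul_rpow_of_nonneg _ _ (by positivity), ← ENNReal.rpow_mul,
        mul_one_div_cancel (by positivity), ENNReal.rpow_one]

/-- selection of good points -/
theorem select_aux (T : ℝ) (a b : ℝ) (ha : 0 ≤ a) (hab : a < b) (hb : b ≤ T)
    (f : ℝ → ℝ) (p : ℝ≥0∞) (hp : 1 ≤ p) (hp' : p ≠ ⊤) (K R : ℝ) (hR : 0 ≤ R)
    (hKR : ENNReal.ofReal K < ENNReal.ofReal R * ENNReal.ofReal (b - a) ^ (1 / p.toReal))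
    (hf : eLpNorm f p (volume.restrict (Set.Ioc (0 : ℝ) T)) ≤ ENNReal.ofReal K)
    (P : ℝ → Prop) (hP : ∀ᵐ t ∂volume.restrict (Set.Icc (0 : ℝ) T), P t) :
    ∃ t ∈ Set.Ioc a b, P t ∧ f t ≤ R := by
  by_contra hcon
  push Not at hcon
  have hsub : Set.Ioc a b ⊆ Set.Ioc 0 T := Set.Ioc_subset_Ioc ha hb
  have hp0 : p ≠ 0 := (lt_of_lt_of_le one_pos hp).ne'
  have hP' : ∀ᵐ t ∂volume.restrict (Set.Ioc a b), P t :=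
    ae_restrict_of_ae_restrict_of_subset (hsub.trans Set.Ioc_subset_Icc_self) hP
  have h1 : eLpNorm (fun _ : ℝ => R) p (volume.restrict (Set.Ioc a b))
      ≤ eLpNorm f p (volume.restrict (Set.Ioc a b)) := by
    refine eLpNorm_mono_ae ?_
    filter_upwards [hP', ae_restrict_mem measurableSet_Ioc] with t ht1 ht2
    have := hcon t ht2 ht1
    rw [Real.norm_of_nonneg hR]
    exact this.le.trans (le_abs_self _)
  have h2 : eLpNorm f p (volume.restrict (Set.Ioc a b)) ≤ ENNReal.ofReal K :=
    (eLpNorm_mono_measure _ (Measure.restrict_mono hsub le_rfl)).trans hf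
  rw [eLpNorm_const' _ hp0 hp', Measure.restrict_apply_univ, Real.volume_Ioc,
    Real.enorm_of_nonneg hR] at h1
  exact absurd (h1.trans h2) (not_le.2 hKR)

/-- pointwise control by the cell mass -/
theorem cell_osc {A₁ : Type*} [NormedAddCommGroup A₁] [NormedSpace ℝ A₁]
    (T h : ℝ) (hh : 0 < h) (w : ℝ → A₁) (hw : IntegrableOn w (Set.Ioc (0 : ℝ) T))
    (s t : ℝ) (hs : s ∈ Set.Ioc 0 T) (ht : t ∈ Set.Ioc 0 T) (hst : ⌈s / h⌉ = ⌈t / h⌉) :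
    ‖(∫ r in (0 : ℝ)..t, w r) - ∫ r in (0 : ℝ)..s, w r‖ ≤ (cellMass T h w t).toReal := by
  have hi : ∀ x ∈ Set.Ioc (0:ℝ) T, IntervalIntegrable w volume 0 x := fun x hx => by
    rw [intervalIntegrable_iff_integrableOn_Ioc_of_le hx.1.le]
    exact hw.mono_set (Set.Ioc_subset_Ioc le_rfl hx.2)
  rw [intervalIntegral.integral_interval_sub_left (hi t ht) (hi s hs)]
  have hfin : cellMass T h w t ≠ ⊤ :=
    ((cellMass_le T h w t).trans_lt hw.2).ne
  rw [← toReal_enorm]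
  refine ENNReal.toReal_mono hfin ?_
  rw [cellMass_eq T h hh, lintegral_indicator measurableSet_Ioc,
    Measure.restrict_restrict measurableSet_Ioc, ← ofReal_norm,
    intervalIntegral.norm_intervalIntegral_eq, ofReal_norm]
  refine (enorm_integral_le_lintegral_enorm _).trans ?_
  refine lintegral_mono_set ?_
  have hs' : s ∈ Set.Ioc ((⌈t / h⌉ - 1) * h) (⌈t / h⌉ * h) := by
    rw [← cell_eq h hh]; exact hst
  have ht' : t ∈ Set.Ioc ((⌈t / h⌉ - 1) * h) (⌈t / h⌉ * h) := by
    rw [← cell_eq h hh]; rfl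
  intro r hr
  rw [Set.mem_uIoc] at hr
  rcases hr with hr | hr
  · exact ⟨⟨hs'.1.trans hr.1, hr.2.trans ht'.2⟩, hs.1.trans hr.1, hr.2.trans ht.2⟩
  · exact ⟨⟨ht'.1.trans hr.1, hr.2.trans hs'.2⟩, ht.1.trans hr.1, hr.2.trans hs.2⟩

/-- the norm estimate -/
theorem norm_est {A₀ : Type*} [NormedAddCommGroup A₀] 
    (μ : Measure ℝ) [IsFiniteMeasure μ]
    (p : ℝ≥0∞) (hp : 1 ≤ p) (hp' : p ≠ ⊤) (K η D h T c : ℝ) (hK : 0 ≤ K) (hη : 0 ≤ η) (hD : 0 ≤ D)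
    (hh : 0 ≤ h) (hT : 0 ≤ T) (hc : 0 ≤ c) (hμ : μ Set.univ = ENNReal.ofReal T)
    (f : ℝ → A₀) (a b G H : ℝ → ℝ)
    (ha : AEMeasurable a μ) (hb : AEMeasurable b μ) (hG : AEMeasurable G μ) (hH : AEMeasurable H μ)
    (ha' : eLpNorm a p μ ≤ ENNReal.ofReal K) (hb' : eLpNorm b p μ ≤ ENNReal.ofReal K)
    (hG' : eLpNorm G p μ ≤ ENNReal.ofReal K * ENNReal.ofReal h ^ (1 / p.toReal))
    (hH' : eLpNorm H p μ ≤ ENNReal.ofReal K * ENNReal.ofReal h ^ (1 / p.toReal))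
    (hf : ∀ᵐ t ∂μ, ‖f t‖ ≤ η * (a t + b t) + D * ((G t + H t) + c)) :
    eLpNorm f p μ ≤ ENNReal.ofReal (η * (K + K) + 
      D * ((K * h ^ (1 / p.toReal) + K * h ^ (1 / p.toReal)) + c * T ^ (1 / p.toReal))) := by
  have hp0 : p ≠ 0 := (lt_of_lt_of_le one_pos hp).ne'
  have h1 : eLpNorm f p μ ≤ eLpNorm (η • (a + b) + D • ((G + H) + fun _ => c)) p μ :=
    eLpNorm_mono_ae_real hf
  have m1 := ha.aestronglyMeasurable
  have m2 := hb.aestronglyMeasurable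
  have m3 := hG.aestronglyMeasurable
  have m4 := hH.aestronglyMeasurable
  have m5 : AEStronglyMeasurable (fun _ : ℝ => c) μ := aestronglyMeasurable_const
  refine h1.trans ?_
  refine (eLpNorm_add_le ((m1.add m2).const_smul η) (((m3.add m4).add m5).const_smul D) hp).trans ?_
  rw [eLpNorm_const_smul, eLpNorm_const_smul, Real.enorm_of_nonneg hη, Real.enorm_of_nonneg hD]
  have q0 : 0 ≤ 1 / p.toReal := by positivity
  have hhq : 0 ≤ h ^ (1 / p.toReal) := by positivity
  have hTq : 0 ≤ T ^ (1 / p.toReal) := by positivity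
  have e5 : eLpNorm (fun _ : ℝ => c) p μ = ENNReal.ofReal c * ENNReal.ofReal T ^ (1 / p.toReal) := by
    rw [eLpNorm_const' _ hp0 hp', hμ, Real.enorm_of_nonneg hc]
  rw [ENNReal.ofReal_add (by positivity) (by positivity), ENNReal.ofReal_mul hη,
    ENNReal.ofReal_mul hD, ENNReal.ofReal_add hK hK, ENNReal.ofReal_add (by positivity) (by positivity),
    ENNReal.ofReal_add (by positivity) (by positivity), ENNReal.ofReal_mul hK, ENNReal.ofReal_mul hc,
    ← ENNReal.ofReal_rpow_of_nonneg hh q0, ← ENNReal.ofReal_rpow_of_nonneg hT q0]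
  gcongr
  · exact (eLpNorm_add_le m1 m2 hp).trans (add_le_add ha' hb')
  · refine (eLpNorm_add_le (m3.add m4) m5 hp).trans (add_le_add ?_ e5.le)
    refine (eLpNorm_add_le m3 m4 hp).trans ?_
    refine add_le_add hG' hH' |>.trans ?_
    exact le_refl _


/-- Dubinskiĭ's theorem, case (b): A₀ ↪ A₁ Banach spaces, M₊ a seminormed nonnegative
cone compactly embedded in A₀, 1 ≤ p < ∞, p₁ = 1. Then Y₊ is compactly embedded in
L^p(0,T;A₀): every [·]_{Y₊}-bounded sequence has a subsequence converging in L^p(0,T;A₀). -/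
theorem stmt9
    {A₀ A₁ : Type*} [NormedAddCommGroup A₀] [NormedSpace ℝ A₀] [CompleteSpace A₀]
    [NormedAddCommGroup A₁] [NormedSpace ℝ A₁] [CompleteSpace A₁]
    -- A₀ is continuously embedded in A₁ via the injective linear map `ι`
    (ι : A₀ →ₗ[ℝ] A₁) (hι : Function.Injective ι)
    (C : ℝ) (hC : 0 < C) (hιC : ∀ a : A₀, ‖ι a‖ ≤ C * ‖a‖)
    (T : ℝ) (hT : 0 < T)
    -- M₊ = S is a seminormed nonnegative cone in A₀ with seminorm ν
    (S : Set A₀) (ν : A₀ → ℝ)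
    (hcone : ∀ φ ∈ S, ∀ c : ℝ, 0 ≤ c → c • φ ∈ S)
    (hν0 : ∀ φ ∈ S, 0 ≤ ν φ)
    (hνeq0 : ∀ φ ∈ S, (ν φ = 0 ↔ φ = 0))
    (hνhom : ∀ φ ∈ S, ∀ c : ℝ, 0 ≤ c → ν (c • φ) = c * ν φ)
    -- M₊ is embedded in A₀
    (hemb : ∃ K₀ > (0 : ℝ), ∀ φ ∈ S, ‖φ‖ ≤ K₀ * ν φ)
    -- the embedding of M₊ in A₀ is compact
    (hcpt : ∀ a : ℕ → A₀, (∀ n, a n ∈ S) → (∃ K : ℝ, ∀ n, ν (a n) ≤ K) →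
      ∃ (ψ : ℕ → ℕ) (l : A₀), StrictMono ψ ∧
        Tendsto (fun n => a (ψ n)) atTop (𝓝 l))
    -- 1 ≤ p < ∞ and p₁ = 1
    (p : ℝ≥0∞) (hp : 1 ≤ p) (hp' : p ≠ ⊤)
    -- (u_n) is a sequence in Y₊, with derivatives (w_n) taking values in A₁
    (u : ℕ → ℝ → A₀) (w : ℕ → ℝ → A₁)
    (huS : ∀ n, ∀ t ∈ Set.Icc (0 : ℝ) T, u n t ∈ S)
    (humeas : ∀ n, AEStronglyMeasurable (u n) (volume.restrict (Set.Ioc (0 : ℝ) T)))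
    (hνmeas : ∀ n, AEMeasurable (fun t => ν (u n t)) (volume.restrict (Set.Ioc (0 : ℝ) T)))
    (hwint : ∀ n, IntegrableOn (w n) (Set.Ioc (0 : ℝ) T))
    (hrep : ∀ n, ∀ᵐ t ∂volume.restrict (Set.Icc (0 : ℝ) T),
      ι (u n t) = ι (u n 0) + ∫ s in (0 : ℝ)..t, w n s)
    -- the sequence is bounded in Y₊: sup_n [u_n]_{Y₊} < ∞
    (K : ℝ)
    (hbound : ∀ n,
      eLpNorm (fun t => ν (u n t)) p (volume.restrict (Set.Ioc (0 : ℝ) T))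
        + eLpNorm (w n) 1 (volume.restrict (Set.Ioc (0 : ℝ) T)) ≤ ENNReal.ofReal K) :
    ∃ ψ : ℕ → ℕ, StrictMono ψ ∧
      ∃ g : ℝ → A₀,
        Tendsto
          (fun j => eLpNorm (fun t => u (ψ j) t - g t) p (volume.restrict (Set.Ioc (0 : ℝ) T)))
          atTop (𝓝 0) := by
  classical
  let L : A₀ →L[ℝ] A₁ := ι.mkContinuous C hιC
  have hL : ∀ a, L a = ι a := fun a => rfl
  set μ := volume.restrict (Set.Ioc (0 : ℝ) T) with hμdef
  have hμ : μ Set.univ = ENNReal.ofReal T := by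
    rw [hμdef, Measure.restrict_apply_univ, Real.volume_Ioc, sub_zero]
  obtain ⟨K₀, hK₀, hemb⟩ := hemb
  obtain ⟨K', hK'0, hbν, hbw⟩ : ∃ K' : ℝ, 0 ≤ K' ∧
      (∀ n, eLpNorm (fun t => ν (u n t)) p μ ≤ ENNReal.ofReal K') ∧
      (∀ n, ∫⁻ s in Set.Ioc (0:ℝ) T, ‖w n s‖ₑ ≤ ENNReal.ofReal K') := by
    refine ⟨max K 0, le_max_right _ _, fun n => ?_, fun n => ?_⟩
    · exact (le_self_add.trans (hbound n)).trans (ENNReal.ofReal_le_ofReal (le_max_left _ _))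
    · rw [← eLpNorm_one_eq_lintegral_enorm]
      exact (le_add_self.trans (hbound n)).trans (ENNReal.ofReal_le_ofReal (le_max_left _ _))
  have hmem : ∀ n, MemLp (u n) p μ := by
    intro n
    have h1 : MemLp (fun t => ν (u n t)) p μ :=
      ⟨(hνmeas n).aestronglyMeasurable, (hbν n).trans_lt ENNReal.ofReal_lt_top⟩
    refine MemLp.of_le_mul (c := K₀) h1 (humeas n) ?_
    filter_upwards [ae_restrict_mem measurableSet_Ioc] with t ht
    have hS := huS n t (Set.Ioc_subset_Icc_self ht)
    rw [Real.norm_of_nonneg (hν0 _ hS)]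
    exact hemb _ hS
  haveI : Fact (1 ≤ p) := ⟨hp⟩
  have hTB : TotallyBounded (Set.range (fun n => (hmem n).toLp (u n))) := by
    refine Metric.totallyBounded_of_finite_discretization fun ε hε => ?_
    obtain ⟨η, hη, hη'⟩ := exists_pos_mul_lt (show 0 < ε / 3 by positivity) (K' + K')
    obtain ⟨D, hD, hE⟩ := ehrling_aux L hι S ν hcone hν0 hνeq0 hνhom hcpt η hη
    have hp1 : 1 ≤ p.toReal := by
      have := ENNReal.toReal_mono hp' hp
      simpa using this
    have hq : 0 < 1 / p.toReal := by positivity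
    obtain ⟨N, hN, hN'⟩ : ∃ N : ℕ, 0 < N ∧
        D * (K' * (T / N) ^ (1 / p.toReal) + K' * (T / N) ^ (1 / p.toReal)) < ε / 3 := by
      have h1 : Tendsto (fun N : ℕ => T / (N : ℝ)) atTop (𝓝 0) :=
        tendsto_const_div_atTop_nhds_zero_nat T
      have h2 : Tendsto (fun N : ℕ => (T / (N : ℝ)) ^ (1 / p.toReal)) atTop (𝓝 0) := by
        have := h1.rpow_const (p := 1 / p.toReal) (Or.inr hq.le)
        rwa [Real.zero_rpow hq.ne'] at this
      have h3 : Tendsto (fun N : ℕ => D * (K' * (T / N) ^ (1 / p.toReal)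
          + K' * (T / N) ^ (1 / p.toReal))) atTop (𝓝 0) := by
        simpa using ((h2.const_mul K').add (h2.const_mul K')).const_mul D
      have h4 := (h3.eventually (gt_mem_nhds (show 0 < ε / 3 by positivity))).and
        (eventually_gt_atTop 0)
      obtain ⟨N, ha, hb⟩ := h4.exists
      exact ⟨N, hb, ha⟩
    set h := T / N with hhdef
    have hN0 : (0 : ℝ) < N := by exact_mod_cast hN
    have hh : 0 < h := by positivity
    have hNh : N * h = T := by rw [hhdef]; field_simp
    obtain ⟨δ, hδ, hδ'⟩ := exists_pos_mul_lt (show 0 < ε / 3 by positivity)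
      (D * (C * 2) * T ^ (1 / p.toReal))
    -- choice of R
    obtain ⟨R, hR, hKR⟩ : ∃ R : ℝ, 0 ≤ R ∧ 
        ENNReal.ofReal K' < ENNReal.ofReal R * ENNReal.ofReal h ^ (1 / p.toReal) := by
      have hhq : 0 < h ^ (1 / p.toReal) := by positivity
      refine ⟨(K' + 1) / h ^ (1 / p.toReal), by positivity, ?_⟩
      rw [ENNReal.ofReal_rpow_of_nonneg hh.le hq.le, ← ENNReal.ofReal_mul (by positivity),
        div_mul_cancel₀ _ hhq.ne']
      exact (ENNReal.ofReal_lt_ofReal_iff (by positivity)).2 (by linarith)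
    have hsel : ∀ n : ℕ, ∀ j : {j : ℤ // j ∈ Finset.Icc (1 : ℤ) N},
        ∃ t ∈ Set.Ioc (((j : ℤ) - 1) * h) ((j : ℤ) * h),
          (ι (u n t) = ι (u n 0) + ∫ s in (0 : ℝ)..t, w n s) ∧ ν (u n t) ≤ R := by
      rintro n ⟨j, hj⟩
      rw [Finset.mem_Icc] at hj
      have hj1 : (1 : ℝ) ≤ j := by exact_mod_cast hj.1
      have hj2 : (j : ℝ) ≤ N := by exact_mod_cast hj.2
      refine select_aux T _ _ (mul_nonneg (by linarith) hh.le) (by nlinarith) (by nlinarith)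
        _ p hp hp' K' R hR ?_ (hbν n) _ (hrep n)
      have : (j : ℝ) * h - (j - 1) * h = h := by ring
      rw [this]
      exact hKR
    choose τ hτ hτrep hτR using hsel
    have hτT : ∀ n j, τ n j ∈ Set.Ioc 0 T := by
      intro n j
      have hj := Finset.mem_Icc.1 j.2
      have hj1 : (1 : ℝ) ≤ (j : ℤ) := by exact_mod_cast hj.1
      have hj2 : ((j : ℤ) : ℝ) ≤ N := by exact_mod_cast hj.2
      have := hτ n j
      exact ⟨lt_of_le_of_lt (mul_nonneg (by linarith) hh.le) this.1, this.2.trans (by nlinarith)⟩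
    have hτc : ∀ n j, ⌈τ n j / h⌉ = (j : ℤ) := by
      intro n j
      have := hτ n j
      rw [← cell_eq h hh] at this
      exact this
    have hTBS : TotallyBounded {φ | φ ∈ S ∧ ν φ ≤ R} :=
      totBdd_aux _ fun a ha => hcpt a (fun n => (ha n).1) ⟨R, fun n => (ha n).2⟩
    obtain ⟨F, hFfin, hF⟩ := Metric.totallyBounded_iff.1 hTBS δ hδ
    have hcov : ∀ n j, ∃ y : F, dist (u n (τ n j)) y < δ := by
      intro n j
      have := hF ⟨huS n _ (Set.Ioc_subset_Icc_self (hτT n j)), hτR n j⟩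
      simp only [Set.mem_iUnion, Metric.mem_ball, exists_prop] at this
      obtain ⟨y, hy, hy'⟩ := this
      exact ⟨⟨y, hy⟩, hy'⟩
    choose d hd using hcov
    haveI : Fintype F := hFfin.fintype
    have hidx : ∀ x : Set.range (fun n => (hmem n).toLp (u n)), ∃ n, (hmem n).toLp (u n) = x :=
      fun x => x.2
    choose k hk using hidx
    refine ⟨{j : ℤ // j ∈ Finset.Icc (1 : ℤ) N} → F, inferInstance, fun x => d (k x), ?_⟩
    intro x y hxy
    change d (k x) = d (k y) at hxy
    rw [← hk x, ← hk y]
    generalize k x = m at hxy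
    generalize k y = n at hxy
    have hest : eLpNorm (fun t => u m t - u n t) p μ ≤ ENNReal.ofReal (η * (K' + K') + 
      D * ((K' * h ^ (1 / p.toReal) + K' * h ^ (1 / p.toReal)) + (C * (2 * δ)) * T ^ (1 / p.toReal))) := by
      refine norm_est μ p hp hp' K' η D h T (C * (2 * δ)) hK'0 hη.le hD.le hh.le hT.le (by positivity) hμ
        _ (fun t => ν (u m t)) (fun t => ν (u n t)) (fun t => (cellMass T h (w m) t).toReal)
        (fun t => (cellMass T h (w n) t).toReal) (hνmeas m) (hνmeas n)
        (cellMass_meas T h (w m) (hwint m).1).ennreal_toReal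
        (cellMass_meas T h (w n) (hwint n).1).ennreal_toReal
        (hbν m) (hbν n) (cellMass_eLpNorm T h hh _ (hwint m).1 p hp hp' _ (hbw m))
        (cellMass_eLpNorm T h hh _ (hwint n).1 p hp hp' _ (hbw n)) ?_
      have hrep' : ∀ n, ∀ᵐ t ∂μ, ι (u n t) = ι (u n 0) + ∫ s in (0 : ℝ)..t, w n s := fun n =>
        ae_restrict_of_ae_restrict_of_subset Set.Ioc_subset_Icc_self (hrep n)
      filter_upwards [hrep' m, hrep' n, ae_restrict_mem measurableSet_Ioc] with t h1 h2 ht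
      have ht' := Set.Ioc_subset_Icc_self ht
      refine (hE _ (huS m t ht') _ (huS n t ht')).trans ?_
      gcongr
      simp only [hL]
      have hjm : ⌈t / h⌉ ∈ Finset.Icc (1 : ℤ) N := by
        rw [Finset.mem_Icc]
        constructor
        · have : 0 < ⌈t / h⌉ := Int.ceil_pos.2 (div_pos ht.1 hh)
          omega
        · rw [Int.ceil_le, div_le_iff₀ hh]
          push_cast
          rw [hNh]; exact ht.2
      let j : {j : ℤ // j ∈ Finset.Icc (1 : ℤ) N} := ⟨⌈t / h⌉, hjm⟩
      have hosc : ∀ n, ι (u n t) = ι (u n 0) + ∫ s in (0 : ℝ)..t, w n s →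
          ‖ι (u n t) - ι (u n (τ n j))‖ ≤ (cellMass T h (w n) t).toReal := by
        intro n hn
        rw [hn, hτrep n j, add_sub_add_left_eq_sub]
        exact cell_osc T h hh (w n) (hwint n) _ t (hτT n j) ht (hτc n j)
      have o1 := hosc m h1
      have o2 := hosc n h2
      have o3 : ‖ι (u m (τ m j)) - ι (u n (τ n j))‖ ≤ C * (2 * δ) := by
        rw [← map_sub]
        refine (hιC _).trans ?_
        gcongr
        rw [← dist_eq_norm]
        have e1 := hd m j
        have e2 := hd n j
        rw [← congrFun hxy j] at e2
        linarith [dist_triangle_right (u m (τ m j)) (u n (τ n j)) (d m j : A₀)]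
      calc ‖ι (u m t) - ι (u n t)‖
          = ‖(ι (u m t) - ι (u m (τ m j))) - (ι (u n t) - ι (u n (τ n j)))
            + (ι (u m (τ m j)) - ι (u n (τ n j)))‖ := by congr 1; abel
        _ ≤ _ := (norm_add_le _ _).trans (add_le_add ((norm_sub_le _ _).trans
            (add_le_add o1 o2)) o3)
    rw [Lp.dist_edist, Lp.edist_toLp_toLp]
    refine ENNReal.toReal_lt_of_lt_ofReal (lt_of_le_of_lt hest ?_)
    rw [ENNReal.ofReal_lt_ofReal_iff hε]
    nlinarith
  have hcomp : IsCompact (closure (Set.range (fun n => (hmem n).toLp (u n)))) :=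
    hTB.closure.isCompact_of_isClosed isClosed_closure
  obtain ⟨g, -, ψ, hψ, hlim⟩ := hcomp.tendsto_subseq
    (fun n => subset_closure (Set.mem_range_self (f := fun n => (hmem n).toLp (u n)) n))
  refine ⟨ψ, hψ, g, ?_⟩
  rw [tendsto_iff_edist_tendsto_0] at hlim
  refine hlim.congr fun j => ?_
  simp only [Function.comp_apply]
  rw [Lp.edist_def]
  refine eLpNorm_congr_ae ?_
  filter_upwards [(hmem (ψ j)).coeFn_toLp] with t ht
  simp [ht]
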